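/- Every closed translation-invariant subalgebra A of the algebra WAP(ℝ^N) of weakly almost periodic functions is introverted; in particular the algebras B_∞(ℝ^N) of functions with limits at infinity, AP(ℝ^N) of almost periodic functions, and WAP(ℝ^N) itself are introverted. -/

import Mathlib

open MeasureTheory Filter Topology
open scoped ENNReal NNReal

noncomputable section

abbrev RN (N : ℕ) := Fin N → ℝ

/-- `f` is a bounded uniformly continuous function on `ℝ^N`. -/
def IsBUC {N : ℕ} (f : RN N → ℂ) : Prop :=
  Bornology.IsBounded (Set.range f) ∧ UniformContinuous f

/-- A closed translation-invariant subalgebra of `BUC(ℝ^N)` (closedness with respect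
to uniform convergence). -/
structure TIAlgebra (N : ℕ) where
  carrier : Set (RN N → ℂ)
  buc : ∀ f ∈ carrier, IsBUC f
  add_mem : ∀ f ∈ carrier, ∀ g ∈ carrier, f + g ∈ carrier
  mul_mem : ∀ f ∈ carrier, ∀ g ∈ carrier, f * g ∈ carrier
  smul_mem : ∀ (c : ℂ), ∀ f ∈ carrier, c • f ∈ carrier
  translate_mem : ∀ f ∈ carrier, ∀ a : RN N, (fun x => f (x + a)) ∈ carrier
  closed : ∀ f : RN N → ℂ,
    (∀ ε : ℝ, 0 < ε → ∃ g ∈ carrier, ∀ x, ‖f x - g x‖ ≤ ε) → f ∈ carrier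

/-- A character of `A`: a nonzero multiplicative linear functional on `A`,
bounded, extended by zero off `A`. -/
def IsCharacter {N : ℕ} (A : TIAlgebra N) (μ : (RN N → ℂ) → ℂ) : Prop :=
  (∀ f ∈ A.carrier, ∀ g ∈ A.carrier, μ (f + g) = μ f + μ g) ∧
  (∀ (c : ℂ), ∀ f ∈ A.carrier, μ (c • f) = c * μ f) ∧
  (∀ f ∈ A.carrier, ∀ g ∈ A.carrier, μ (f * g) = μ f * μ g) ∧
  (∃ f ∈ A.carrier, μ f ≠ 0) ∧
  (∀ f, f ∉ A.carrier → μ f = 0) ∧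
  (∀ f ∈ A.carrier, ∀ C : ℝ, (∀ x, ‖f x‖ ≤ C) → ‖μ f‖ ≤ C)

/-- The spectrum `Δ(A)`. -/
abbrev Spectrum' {N : ℕ} (A : TIAlgebra N) :=
  {μ : (RN N → ℂ) → ℂ // IsCharacter A μ}

/-- `A` is introverted: `x ↦ μ (f (· + x))` belongs to `A` for every character `μ`
of `A` and every `f ∈ A`. -/
def Introverted {N : ℕ} (A : TIAlgebra N) : Prop :=
  ∀ μ : Spectrum' A, ∀ f ∈ A.carrier,
    (fun x => μ.1 (fun z => f (z + x))) ∈ A.carrier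

/-- The translate of a bounded continuous function. -/
def translateBCF {N : ℕ} (F : BoundedContinuousFunction (RN N) ℂ) (a : RN N) :
    BoundedContinuousFunction (RN N) ℂ :=
  F.compContinuous ⟨fun x => x + a, by fun_prop⟩

/-- `f` is weakly almost periodic: its set of translates is relatively weakly compact
in `BUC(ℝ^N)` (equivalently, in the Banach space of bounded continuous functions). -/
def IsWAP {N : ℕ} (f : RN N → ℂ) : Prop :=
  ∃ F : BoundedContinuousFunction (RN N) ℂ, ⇑F = f ∧
    IsCompact (closure
      (Set.range (fun a : RN N => translateBCF F a) :
        Set (WeakSpace ℂ (BoundedContinuousFunction (RN N) ℂ))))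

/-- If nonnegative, uniformly bounded continuous functions on a compact space tend to zero
pointwise, then every convex set containing them has an element that is uniformly small. -/
theorem Convex.exists_forall_lt_of_tendsto_zero {K : Type*} [TopologicalSpace K] [CompactSpace K]
    [T2Space K] {S : Set C(K, ℝ)} (hS : Convex ℝ S) {g : ℕ → C(K, ℝ)} (hgS : ∀ n, g n ∈ S)
    {B : ℝ} (hg₀ : ∀ n k, 0 ≤ g n k) (hgB : ∀ n k, g n k ≤ B)
    (hlim : ∀ k, Tendsto (fun n => g n k) atTop (𝓝 0)) {ε : ℝ} (hε : 0 < ε) :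
    ∃ h ∈ S, ∀ k, h k < ε := by
  by_contra! hcon
  let U : Set C(K, ℝ) := {h | ∀ k, h k < ε}
  have hUo : IsOpen U := by
    have : U = {h : C(K, ℝ) | Set.MapsTo h Set.univ (Set.Iio ε)} := by
      ext h; simp [U, Set.MapsTo]
    rw [this]
    exact ContinuousMap.isOpen_setOfPred_mapsTo isCompact_univ isOpen_Iio
  have hUc : Convex ℝ U := by
    intro a ha b hb s t hs ht hst k
    exact convex_Iio ε (ha k) (hb k) hs ht hst
  have hdisj : Disjoint U S := by
    rw [Set.disjoint_left]
    intro h hU hhS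
    obtain ⟨k, hk⟩ := hcon h hhS
    exact absurd (hU k) (not_lt.2 hk)
  obtain ⟨L, s, hLU, hLS⟩ := geometric_hahn_banach_open hUc hUo hS hdisj
  have hs : 0 < s := by simpa using hLU 0 (fun k => by simpa using hε)
  have hpos : ∀ p : C(K, ℝ), 0 ≤ p → 0 ≤ L p := by
    intro p hp
    by_contra! hneg
    have := hLU ((s / L p) • p) (fun k => by
      have h1 : 0 ≤ p k := hp k
      have h2 : s / L p ≤ 0 := div_nonpos_of_nonneg_of_nonpos hs.le hneg.le
      exact (mul_nonpos_of_nonpos_of_nonneg h2 h1).trans_lt hε)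
    rw [map_smul, smul_eq_mul, div_mul_cancel₀ _ hneg.ne] at this
    exact lt_irrefl _ this
  let _ : MeasurableSpace K := borel K
  have _ : BorelSpace K := ⟨rfl⟩
  let Λ : CompactlySupportedContinuousMap K ℝ →ₚ[ℝ] ℝ := PositiveLinearMap.mk₀
    { toFun := fun f => L f.toContinuousMap
      map_add' := fun f g => L.map_add _ _
      map_smul' := fun c f => L.map_smul c f.toContinuousMap }
    (fun f hf => hpos _ hf)
  let m := RealRMK.rieszMeasure Λ
  have hint : ∀ n, ∫ k, g n k ∂m = L (g n) := fun n =>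
    RealRMK.integral_rieszMeasure Λ (CompactlySupportedContinuousMap.continuousMapEquiv (g n))
  have hzero : Tendsto (fun n => ∫ k, g n k ∂m) atTop (𝓝 (∫ _, (0 : ℝ) ∂m)) := by
    refine tendsto_integral_of_dominated_convergence (fun _ => B)
      (fun n => (g n).continuous.aestronglyMeasurable) (integrable_const _) (fun n => ?_)
      (Eventually.of_forall hlim)
    refine Eventually.of_forall fun k => ?_
    rw [Real.norm_of_nonneg (hg₀ n k)]
    exact hgB n k
  rw [integral_zero] at hzero
  refine hs.not_ge (ge_of_tendsto' hzero fun n => ?_)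
  rw [hint]
  exact hLS _ (hgS n)

/-- A functional that is the pointwise limit, on a weakly compact set, of functionals from a convex
set is a uniform limit there of functionals from that convex set. -/
theorem Convex.exists_forall_norm_sub_lt_of_isCompact {X : Type*} [NormedAddCommGroup X]
    [NormedSpace ℂ X] {K : Set (WeakSpace ℂ X)} (hK : IsCompact K) {C : Set (StrongDual ℂ X)}
    (hC : Convex ℝ C) {ν : StrongDual ℂ X} {p : ℕ → StrongDual ℂ X} (hp : ∀ n, p n ∈ C) {B : ℝ}
    (hB : ∀ n, ∀ k ∈ K, ‖(p n - ν) ((toWeakSpace ℂ X).symm k)‖ ≤ B)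
    (hlim : ∀ k ∈ K, Tendsto (fun n => p n ((toWeakSpace ℂ X).symm k)) atTop
      (𝓝 (ν ((toWeakSpace ℂ X).symm k)))) {ε : ℝ} (hε : 0 < ε) :
    ∃ q ∈ C, ∀ k ∈ K, ‖(q - ν) ((toWeakSpace ℂ X).symm k)‖ < ε := by
  have : CompactSpace K := isCompact_iff_compactSpace.1 hK
  let S : Set C(K, ℝ) := {h | ∃ q ∈ C, ∀ k : K, ‖(q - ν) ((toWeakSpace ℂ X).symm k)‖ ≤ h k}
  have hcont : ∀ q : StrongDual ℂ X, Continuous fun k : WeakSpace ℂ X =>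
      q ((toWeakSpace ℂ X).symm k) := fun q =>
    WeakBilin.eval_continuous (topDualPairing ℂ X).flip q
  let g : ℕ → C(K, ℝ) := fun n =>
    ⟨fun k => ‖(p n - ν) ((toWeakSpace ℂ X).symm k)‖,
      ((hcont (p n - ν)).comp continuous_subtype_val).norm⟩
  have hS : Convex ℝ S := by
    rintro a ⟨q, hq, hqa⟩ b ⟨r, hr, hrb⟩ s t hs ht hst
    refine ⟨s • q + t • r, hC hq hr hs ht hst, fun k => ?_⟩
    have hsplit : s • q + t • r - ν = s • (q - ν) + t • (r - ν) := by
      rw [smul_sub, smul_sub, ← add_sub_add_comm, ← add_smul, hst, one_smul]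
    rw [hsplit]
    refine (norm_add_le (s • (q - ν) _) (t • (r - ν) _)).trans ?_
    rw [norm_smul, norm_smul, Real.norm_of_nonneg hs, Real.norm_of_nonneg ht]
    exact add_le_add (mul_le_mul_of_nonneg_left (hqa k) hs) (mul_le_mul_of_nonneg_left (hrb k) ht)
  obtain ⟨h, ⟨q, hq, hqh⟩, hlt⟩ := hS.exists_forall_lt_of_tendsto_zero (g := g) (B := B)
    (fun n => ⟨p n, hp n, fun k => le_rfl⟩) (fun n k => norm_nonneg ((p n - ν) _)) (fun n k => hB n k k.2)
    (fun k => by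
      have := (hlim k k.2).sub_const (ν ((toWeakSpace ℂ X).symm k))
      rw [sub_self] at this
      simpa [g] using this.norm) hε
  exact ⟨q, hq, fun k hk => (hqh ⟨k, hk⟩).trans_lt (hlt ⟨k, hk⟩)⟩

/-- A functional dominated by the support function of a convex set of functionals can be
approximated by elements of this set on finitely many vectors. -/
theorem Convex.exists_forall_norm_sub_lt_of_finite {X : Type*} [NormedAddCommGroup X]
    [NormedSpace ℂ X] {C : Set (StrongDual ℂ X)} (hC : Convex ℝ C) {ν : StrongDual ℂ X}
    (hν : ∀ y s, (∀ p ∈ C, (p y).re ≤ s) → (ν y).re ≤ s) {ι : Type*} [Fintype ι] (y : ι → X)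
    {ε : ℝ} (hε : 0 < ε) : ∃ p ∈ C, ∀ i, ‖p (y i) - ν (y i)‖ < ε := by
  classical
  let T : StrongDual ℂ X →ₗ[ℝ] (ι → ℂ) :=
    { toFun := fun p i => p (y i), map_add' := fun _ _ => rfl, map_smul' := fun _ _ => rfl }
  have hmem : T ν ∈ closure (T '' C) := by
    by_contra hnot
    obtain ⟨L, u, hLu, huL⟩ := RCLike.geometric_hahn_banach_closed_point (𝕜 := ℂ)
      (hC.linear_image T).closure isClosed_closure hnot
    have hL : ∀ p : StrongDual ℂ X, L (T p) = p (∑ i, L (Pi.single i 1) • y i) := by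
      intro p
      conv_lhs => rw [pi_eq_sum_univ' (T p)]
      simp only [map_sum, map_smul, smul_eq_mul]
      exact Finset.sum_congr rfl fun i _ => by
        rw [mul_comm]; rfl
    refine huL.not_ge ?_
    rw [hL]
    refine hν _ _ fun p hp => ?_
    rw [← hL]
    exact (hLu _ (subset_closure ⟨p, hp, rfl⟩)).le
  obtain ⟨_, ⟨p, hp, rfl⟩, hdist⟩ := Metric.mem_closure_iff.1 hmem ε hε
  refine ⟨p, hp, fun i => ?_⟩
  rw [← dist_eq_norm, dist_comm]
  exact (dist_le_pi_dist (T ν) (T p) i).trans_lt hdist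

/-- Translation is norm continuous on uniformly continuous functions. -/
theorem continuous_translateBCF {N : ℕ} {F : BoundedContinuousFunction (RN N) ℂ}
    (hF : UniformContinuous F) : Continuous (translateBCF F) := by
  rw [Metric.continuous_iff]
  intro b ε hε
  obtain ⟨δ, hδ, h⟩ := Metric.uniformContinuous_iff.1 hF (ε / 2) (half_pos hε)
  refine ⟨δ, hδ, fun a hab => ?_⟩
  refine ((BoundedContinuousFunction.dist_le (half_pos hε).le).2 fun x => ?_).trans_lt
    (half_lt_self hε)
  exact (h (by simpa using hab)).le

/-- A closed convex set containing a set contains its weak closure. -/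
theorem Convex.weakSpace_closure_subset {X : Type*} [NormedAddCommGroup X] [NormedSpace ℂ X]
    {s : Set X} (hs : Convex ℝ s) (hsc : IsClosed s) {O : Set (WeakSpace ℂ X)}
    (hO : ∀ k ∈ O, (toWeakSpace ℂ X).symm k ∈ s) :
    ∀ k ∈ closure O, (toWeakSpace ℂ X).symm k ∈ s := by
  have hsub : closure O ⊆ toWeakSpace ℂ X '' s := by
    refine closure_minimal (fun k hk => ⟨_, hO k hk, by simp⟩) ?_
    have := hs.toWeakSpace_closure ℂ
    rw [hsc.closure_eq] at this
    rw [this]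
    exact isClosed_closure
  intro k hk
  obtain ⟨x, hx, rfl⟩ := hsub hk
  simpa using hx

/-- The vectors on which a sequence of functionals converges to a given functional. -/
def convergenceSubmodule {X : Type*} [NormedAddCommGroup X] [NormedSpace ℂ X]
    (p : ℕ → StrongDual ℂ X) (ν : StrongDual ℂ X) : Submodule ℂ X where
  carrier := {y | Tendsto (fun n => p n y) atTop (𝓝 (ν y))}
  add_mem' := fun ha hb => by simpa using Tendsto.add ha hb
  zero_mem' := by simp
  smul_mem' := fun c y hy => by simpa using Tendsto.const_mul c hy

theorem isClosed_convergenceSubmodule {X : Type*} [NormedAddCommGroup X] [NormedSpace ℂ X]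
    {p : ℕ → StrongDual ℂ X} {ν : StrongDual ℂ X} (hp : ∀ n, ‖p n‖ ≤ 1) (hν : ‖ν‖ ≤ 1) :
    IsClosed (convergenceSubmodule p ν : Set X) := by
  refine isClosed_of_closure_subset fun y hy => ?_
  change Tendsto _ _ _
  rw [Metric.tendsto_atTop]
  intro ε hε
  obtain ⟨z, hz, hyz⟩ := Metric.mem_closure_iff.1 hy (ε / 3) (by positivity)
  obtain ⟨n₀, hn₀⟩ := Metric.tendsto_atTop.1 (show Tendsto _ _ _ from hz) (ε / 3) (by positivity)
  refine ⟨n₀, fun n hn => ?_⟩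
  have h1 : dist (p n y) (p n z) ≤ dist y z := by
    rw [dist_eq_norm, dist_eq_norm, ← map_sub]
    exact (p n).le_of_opNorm_le (hp n) _ |>.trans_eq (one_mul _)
  have h2 : dist (ν z) (ν y) ≤ dist y z := by
    rw [dist_comm, dist_eq_norm, dist_eq_norm, ← map_sub]
    exact ν.le_of_opNorm_le hν _ |>.trans_eq (one_mul _)
  have h3 := dist_triangle4 (p n y) (p n z) (ν z) (ν y)
  linarith [hn₀ n hn]

/-- A character extends to a functional of norm at most one on all bounded continuous functions. -/
theorem IsCharacter.exists_extension {N : ℕ} {A : TIAlgebra N} {μ : (RN N → ℂ) → ℂ}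
    (hμ : IsCharacter A μ) : ∃ ν : StrongDual ℂ (BoundedContinuousFunction (RN N) ℂ),
      ‖ν‖ ≤ 1 ∧ ∀ F : BoundedContinuousFunction (RN N) ℂ, ⇑F ∈ A.carrier → ν F = μ F := by
  obtain ⟨hadd, hsmul, -, ⟨e, he, -⟩, -, hbound⟩ := hμ
  let V : Submodule ℂ (BoundedContinuousFunction (RN N) ℂ) :=
    { carrier := {F | ⇑F ∈ A.carrier}
      add_mem' := fun ha hb => A.add_mem _ ha _ hb
      zero_mem' := by simpa using A.smul_mem 0 e he
      smul_mem' := fun c F hF => A.smul_mem c _ hF }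
  let l : V →ₗ[ℂ] ℂ :=
    { toFun := fun F => μ F.1
      map_add' := fun F G => hadd _ F.2 _ G.2
      map_smul' := fun c F => hsmul c _ F.2 }
  have hl : ∀ F : V, ‖l F‖ ≤ 1 * ‖F‖ := fun F => by
    rw [one_mul]
    exact hbound _ F.2 _ fun x => F.1.norm_coe_le_norm x
  obtain ⟨ν, hν, hnorm⟩ := exists_extension_norm_eq V (l.mkContinuous 1 hl)
  refine ⟨ν, hnorm.trans_le (l.mkContinuous_norm_le zero_le_one hl), fun F hF => ?_⟩
  exact hν ⟨F, hF⟩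

/-- The functionals of norm at most one whose values along the orbit of `F` define an element
of `A`. -/
def orbitFunctionals {N : ℕ} (A : TIAlgebra N) (F : BoundedContinuousFunction (RN N) ℂ) :
    Set (StrongDual ℂ (BoundedContinuousFunction (RN N) ℂ)) :=
  {p | ‖p‖ ≤ 1 ∧ (fun a => p (translateBCF F a)) ∈ A.carrier}

theorem convex_orbitFunctionals {N : ℕ} (A : TIAlgebra N)
    (F : BoundedContinuousFunction (RN N) ℂ) : Convex ℝ (orbitFunctionals A F) := by
  rintro p ⟨hp, hpA⟩ q ⟨hq, hqA⟩ s t hs ht hst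
  refine ⟨?_, ?_⟩
  · have := convex_closedBall (0 : StrongDual ℂ (BoundedContinuousFunction (RN N) ℂ)) 1
      (mem_closedBall_zero_iff.2 hp) (mem_closedBall_zero_iff.2 hq) hs ht hst
    exact mem_closedBall_zero_iff.1 this
  · convert A.add_mem _ (A.smul_mem (s : ℂ) _ hpA) _ (A.smul_mem (t : ℂ) _ hqA) using 1
    ext a
    simp

theorem smul_evalCLM_mem_orbitFunctionals {N : ℕ} {A : TIAlgebra N}
    {F : BoundedContinuousFunction (RN N) ℂ} (hF : ⇑F ∈ A.carrier) {c : ℂ} (hc : ‖c‖ ≤ 1)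
    (x : RN N) : c • BoundedContinuousFunction.evalCLM ℂ x ∈ orbitFunctionals A F := by
  refine ⟨ContinuousLinearMap.opNorm_le_bound _ zero_le_one fun G => ?_, ?_⟩
  · change ‖c * G x‖ ≤ _
    rw [norm_mul]
    exact mul_le_mul hc (G.norm_coe_le_norm x) (norm_nonneg _) zero_le_one
  · convert A.smul_mem c _ (A.translate_mem _ hF x) using 1
    ext a
    change c * F (x + a) = c * F (a + x)
    rw [add_comm]

/-- Functionals of norm at most one are dominated by the support function of
`orbitFunctionals A F`. -/
theorem re_le_of_forall_orbitFunctionals {N : ℕ} {A : TIAlgebra N}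
    {F : BoundedContinuousFunction (RN N) ℂ} (hF : ⇑F ∈ A.carrier)
    {ν : StrongDual ℂ (BoundedContinuousFunction (RN N) ℂ)} (hν : ‖ν‖ ≤ 1)
    (G : BoundedContinuousFunction (RN N) ℂ) (s : ℝ)
    (hs : ∀ p ∈ orbitFunctionals A F, (p G).re ≤ s) : (ν G).re ≤ s := by
  have hG : ‖G‖ ≤ s := by
    refine (BoundedContinuousFunction.norm_le_of_nonempty).2 fun x => ?_
    obtain ⟨c, hc, hcx⟩ : ∃ c : ℂ, ‖c‖ ≤ 1 ∧ c * G x = ‖G x‖ := by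
      by_cases h0 : G x = 0
      · exact ⟨0, by simp, by simp [h0]⟩
      · refine ⟨‖G x‖ / G x, by simp [h0], div_mul_cancel₀ _ h0⟩
    have := hs _ (smul_evalCLM_mem_orbitFunctionals hF hc x)
    change (c * G x).re ≤ s at this
    rwa [hcx, Complex.ofReal_re] at this
  calc (ν G).re ≤ ‖ν G‖ := Complex.re_le_norm _
    _ ≤ 1 * ‖G‖ := ν.le_of_opNorm_le hν G
    _ ≤ s := by rwa [one_mul]

/-- Every closed translation-invariant subalgebra of the algebra
`WAP(ℝ^N)` of weakly almost periodic functions is introverted (in particular the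
algebras `B_∞(ℝ^N)`, `AP(ℝ^N)` and `WAP(ℝ^N)` themselves are introverted). -/
theorem stmt2 {N : ℕ} (A : TIAlgebra N) (h : ∀ f ∈ A.carrier, IsWAP f) :
    Introverted A := by
  intro μ f hf
  obtain ⟨F, rfl, hK⟩ := h f hf
  obtain ⟨ν, hν, hνμ⟩ := μ.2.exists_extension
  have hgoal : (fun x => μ.1 (fun z => F (z + x))) = fun x => ν (translateBCF F x) :=
    funext fun x => (hνμ (translateBCF F x) (A.translate_mem _ hf x)).symm
  rw [hgoal]
  have happrox : ∀ n : ℕ, ∃ p ∈ orbitFunctionals A F, ∀ i : Fin n,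
      ‖p (translateBCF F (TopologicalSpace.denseSeq (RN N) i)) -
        ν (translateBCF F (TopologicalSpace.denseSeq (RN N) i))‖ < 1 / ((n : ℝ) + 1) := fun n =>
    (convex_orbitFunctionals A F).exists_forall_norm_sub_lt_of_finite
      (re_le_of_forall_orbitFunctionals hf hν) _ Nat.one_div_pos_of_nat
  choose p hpC hp using happrox
  have hclosed := isClosed_convergenceSubmodule (fun n => (hpC n).1) hν
  have hdense : ∀ i, translateBCF F (TopologicalSpace.denseSeq (RN N) i) ∈
      convergenceSubmodule p ν := by
    intro i
    refine tendsto_iff_norm_sub_tendsto_zero.2 ?_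
    refine squeeze_zero' (Eventually.of_forall fun n => norm_nonneg _) ?_
      tendsto_one_div_add_atTop_nhds_zero_nat
    filter_upwards [eventually_gt_atTop i] with n hn
    exact (hp n ⟨i, hn⟩).le
  have horbit : ∀ a, translateBCF F a ∈ convergenceSubmodule p ν := by
    intro a
    refine (hclosed.preimage (continuous_translateBCF (A.buc _ hf).2)).closure_subset_iff.2 ?_
      (TopologicalSpace.denseRange_denseSeq (RN N) a)
    rintro _ ⟨i, rfl⟩
    exact hdense i
  have hlim := Convex.weakSpace_closure_subset
    ((convergenceSubmodule p ν).restrictScalars ℝ).convex hclosed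
    (O := Set.range fun a => translateBCF F a) (by rintro _ ⟨a, rfl⟩; exact horbit a)
  have hball := Convex.weakSpace_closure_subset
    (convex_closedBall (0 : BoundedContinuousFunction (RN N) ℂ) ‖F‖) Metric.isClosed_closedBall
    (O := Set.range fun a => translateBCF F a) (by
      rintro _ ⟨a, rfl⟩
      exact mem_closedBall_zero_iff.2
        ((BoundedContinuousFunction.norm_le (norm_nonneg F)).2 fun x => F.norm_coe_le_norm (x + a)))
  refine A.closed _ fun ε hε => ?_
  obtain ⟨q, hq, hqν⟩ := (convex_orbitFunctionals A F).exists_forall_norm_sub_lt_of_isCompact hK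
    hpC (B := 2 * ‖F‖) (fun n k hk => by
      refine (p n - ν).le_of_opNorm_le_of_le ?_ (mem_closedBall_zero_iff.1 (hball k hk))
      exact (norm_sub_le _ _).trans (by linarith [(hpC n).1])) hlim hε
  refine ⟨_, hq.2, fun x => ?_⟩
  rw [norm_sub_rev]
  exact (hqν _ (subset_closure ⟨x, rfl⟩)).le
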